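/- arXiv:2603.00518 — 3 statements merged into one kernel-verified Lean document; each statement's English description precedes it below -/
import Mathlib

section
/- (Batch Gradient Descent TTT equals linear attention.) Let D and T be positive natural numbers, let θ_K, θ_Q, θ_V be D×D real matrices, and let x_1, …, x_T ∈ ℝ^D. Set W_0 = 0 (the zero D×D matrix) and η = 1/2, and define the batch-gradient-descent iterates W_t = W_{t−1} − η · G_t for t = 1, …, T, where G_t = 2·(W_0·(θ_K·x_t) − θ_V·x_t)·(θ_K·x_t)ᵀ is the gradient at W_0 of the reconstruction loss W ↦ ‖W·(θ_K·x_t) − θ_V·x_t‖². Then for every t ∈ {1, …, T}, the hidden state satisfies W_t = ∑_{s=1}^{t} (θ_V·x_s)·(θ_K·x_s)ᵀ, and the output token z_t := W_t·(θ_Q·x_t) satisfies z_t = ∑_{s=1}^{t} (θ_V·x_s) · ⟨θ_K·x_s, θ_Q·x_t⟩, which is exactly the definition of (causal) linear attention. -/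
open Matrix Finset

/-- **Batch Gradient Descent TTT equals linear attention.**
With `W₀ = 0`, `η = 1/2`, and iterates `W_t = W_{t-1} − η • G_t` where
`G_t = 2 (W₀ (θ_K x_t) − θ_V x_t)(θ_K x_t)ᵀ` is the gradient at `W₀` of the
reconstruction loss `W ↦ ‖W (θ_K x_t) − θ_V x_t‖²`, the hidden state satisfies
`W_t = ∑_{s=1}^t (θ_V x_s)(θ_K x_s)ᵀ` and the output token
`z_t = W_t (θ_Q x_t) = ∑_{s=1}^t ⟨θ_K x_s, θ_Q x_t⟩ (θ_V x_s)`, which is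
exactly causal linear attention. -/
theorem batch_gd_ttt_is_linear_attention (D T : ℕ) (hD : 0 < D) (hT : 0 < T)
    (θK θQ θV : Matrix (Fin D) (Fin D) ℝ) (x : ℕ → Fin D → ℝ) (η : ℝ) (hη : η = 1 / 2)
    (W : ℕ → Matrix (Fin D) (Fin D) ℝ) (hW0 : W 0 = 0)
    (hW : ∀ t, 1 ≤ t → t ≤ T →
      W t = W (t - 1) -
        η • ((2 : ℝ) • vecMulVec (W 0 *ᵥ (θK *ᵥ x t) - θV *ᵥ x t) (θK *ᵥ x t))) :
    ∀ t, 1 ≤ t → t ≤ T →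
      W t = ∑ s ∈ Finset.Icc 1 t, vecMulVec (θV *ᵥ x s) (θK *ᵥ x s) ∧
      W t *ᵥ (θQ *ᵥ x t) =
        ∑ s ∈ Finset.Icc 1 t, ((θK *ᵥ x s) ⬝ᵥ (θQ *ᵥ x t)) • (θV *ᵥ x s) := by
  have hsum : ∀ t, t ≤ T →
      W t = ∑ s ∈ Finset.Icc 1 t, vecMulVec (θV *ᵥ x s) (θK *ᵥ x s) := by
    intro t
    induction t with
    | zero => simp [hW0]
    | succ n ih =>
      intro hn
      rw [hW (n + 1) (by omega) hn, Finset.sum_Icc_succ_top (by omega), Nat.add_sub_cancel,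
        ih (by omega), hW0, hη, smul_smul]
      norm_num [neg_vecMulVec]
  intro t _ ht
  refine ⟨hsum t ht, ?_⟩
  rw [hsum t ht, Matrix.sum_mulVec]
  refine Finset.sum_congr rfl fun s _ => ?_
  rw [vecMulVec_mulVec, op_smul_eq_smul]
end

section
/- (Online Gradient Descent TTT: adapted value view.) Let D and T be positive natural numbers, let θ_K, θ_Q, θ_V be D×D real matrices, let x_1, …, x_T ∈ ℝ^D, and let W_0 be any D×D real matrix. Define the online-gradient-descent iterates (learning rate η = 1/2) by W_t = W_{t−1} − (W_{t−1}·(θ_K·x_t) − θ_V·x_t)·(θ_K·x_t)ᵀ for t = 1, …, T. Then for every t ∈ {1, …, T}, the output token z_t := W_t·(θ_Q·x_t) satisfies z_t = W_0·(θ_Q·x_t) + ∑_{s=1}^{t} (θ_V·x_s − W_{s−1}·(θ_K·x_s)) · ⟨θ_K·x_s, θ_Q·x_t⟩, i.e. the output has the form of linear attention in which the value view θ_V·x_s is replaced by the adapted value view θ_V·x_s − W_{s−1}·(θ_K·x_s). -/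
open Matrix Finset

/-- Unrolling of a sequence of rank-one updates `W_t = W_{t-1} - u_t k_tᵀ`, applied to a vector. -/
theorem mulVec_eq_add_sum_of_rankOne_updates {m n R : Type*} [Fintype n] [CommRing R] {T : ℕ}
    {W : ℕ → Matrix m n R} {u : ℕ → m → R} {k : ℕ → n → R}
    (hW : ∀ t, 1 ≤ t → t ≤ T → W t = W (t - 1) - vecMulVec (u t) (k t)) (q : n → R) :
    ∀ t ≤ T, W t *ᵥ q = W 0 *ᵥ q + ∑ s ∈ Finset.Icc 1 t, (k s ⬝ᵥ q) • -u s := by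
  intro t
  induction t with
  | zero => simp
  | succ t ih =>
    intro ht
    rw [hW (t + 1) (by omega) ht, Finset.sum_Icc_succ_top (by omega), Nat.add_sub_cancel,
      sub_mulVec, ih (by omega), vecMulVec_mulVec, op_smul_eq_smul, smul_neg]
    abel

/-- **Online Gradient Descent TTT: adapted value view.**
With arbitrary `W₀`, learning rate `η = 1/2`, and online-gradient-descent
iterates `W_t = W_{t-1} − (W_{t-1} (θ_K x_t) − θ_V x_t)(θ_K x_t)ᵀ`, the output
token `z_t = W_t (θ_Q x_t)` satisfies
`z_t = W₀ (θ_Q x_t) + ∑_{s=1}^t ⟨θ_K x_s, θ_Q x_t⟩ (θ_V x_s − W_{s-1} (θ_K x_s))`,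
i.e. linear attention with the adapted value view. -/
theorem online_gd_ttt_adapted_value_view (D T : ℕ) (hD : 0 < D) (hT : 0 < T)
    (θK θQ θV : Matrix (Fin D) (Fin D) ℝ) (x : ℕ → Fin D → ℝ)
    (W : ℕ → Matrix (Fin D) (Fin D) ℝ)
    (hW : ∀ t, 1 ≤ t → t ≤ T →
      W t = W (t - 1) -
        vecMulVec (W (t - 1) *ᵥ (θK *ᵥ x t) - θV *ᵥ x t) (θK *ᵥ x t)) :
    ∀ t, 1 ≤ t → t ≤ T →
      W t *ᵥ (θQ *ᵥ x t) =
        W 0 *ᵥ (θQ *ᵥ x t) +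
          ∑ s ∈ Finset.Icc 1 t,
            ((θK *ᵥ x s) ⬝ᵥ (θQ *ᵥ x t)) •
              (θV *ᵥ x s - W (s - 1) *ᵥ (θK *ᵥ x s)) := by
  intro t _ ht
  simpa only [neg_sub] using mulVec_eq_add_sum_of_rankOne_updates hW (θQ *ᵥ x t) t ht
end

section
/- (Dual form of the mini-batch outputs: primal–dual equivalence.) Let D and b be positive natural numbers, let x_1, …, x_b ∈ ℝ^D, let W_0 be a D×D real matrix, and let η ∈ ℝ. Define W_t = W_0 − η·∑_{s=1}^{t} 2·(W_0·x_s − x_s)·x_sᵀ for t = 1, …, b, and the primal-form outputs z_t = W_t·x_t. Let X be the D×b matrix whose t-th column is x_t, and let M be the b×b matrix with entries M_{s,t} = ⟨x_s, x_t⟩ if s ≤ t and M_{s,t} = 0 otherwise (the causally masked Gram matrix mask(XᵀX)). Define Δ = (W_0·X − X)·M and the dual-form output matrix Z = W_0·X − 2η·Δ. Then for every t ∈ {1, …, b}, the t-th column of Z equals z_t; equivalently, z_t = W_0·x_t − 2η·∑_{s=1}^{t} (W_0·x_s − x_s)·⟨x_s, x_t⟩. -/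
open Matrix Finset

/-- **Dual form of the mini-batch outputs: primal–dual equivalence.**
In batch-gradient-descent TTT within one mini-batch with identity projections,
`W_t = W₀ − η ∑_{s=1}^t 2 (W₀ x_s − x_s) x_sᵀ` and primal outputs
`z_t = W_t x_t`.  With `X` the matrix of tokens, `M = mask(XᵀX)` the causally
masked Gram matrix, `Δ = (W₀ X − X) M` and `Z = W₀ X − 2η Δ`, the `t`-th
column of `Z` equals `z_t`; equivalently
`z_t = W₀ x_t − 2η ∑_{s=1}^t ⟨x_s, x_t⟩ (W₀ x_s − x_s)`. -/
theorem ttt_dual_form_outputs (D b : ℕ) (hD : 0 < D) (hb : 0 < b)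
    (x : Fin b → Fin D → ℝ) (W₀ : Matrix (Fin D) (Fin D) ℝ) (η : ℝ)
    (W : Fin b → Matrix (Fin D) (Fin D) ℝ)
    (hW : ∀ t, W t = W₀ -
      η • ∑ s ∈ Finset.univ.filter (· ≤ t),
        (2 : ℝ) • vecMulVec (W₀ *ᵥ x s - x s) (x s))
    (z : Fin b → Fin D → ℝ) (hz : ∀ t, z t = W t *ᵥ x t)
    (X : Matrix (Fin D) (Fin b) ℝ) (hX : ∀ i t, X i t = x t i)
    (M : Matrix (Fin b) (Fin b) ℝ)
    (hM : ∀ s t, M s t = if s ≤ t then (x s) ⬝ᵥ (x t) else 0)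
    (Δ Z : Matrix (Fin D) (Fin b) ℝ)
    (hΔ : Δ = (W₀ * X - X) * M) (hZ : Z = W₀ * X - (2 * η) • Δ) :
    ∀ t, (∀ i, Z i t = z t i) ∧
      z t = W₀ *ᵥ x t -
        (2 * η) • ∑ s ∈ Finset.univ.filter (· ≤ t),
          ((x s) ⬝ᵥ (x t)) • (W₀ *ᵥ x s - x s) := by
  have hmul : ∀ i t, (W₀ * X) i t = (W₀ *ᵥ x t) i := fun i t => by
    simp only [mul_apply, mulVec, dotProduct, hX]
  have hz_dual : ∀ t, z t = W₀ *ᵥ x t -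
      (2 * η) • ∑ s ∈ Finset.univ.filter (· ≤ t),
        ((x s) ⬝ᵥ (x t)) • (W₀ *ᵥ x s - x s) := fun t => by
    rw [hz, hW, sub_mulVec, smul_mulVec, sum_mulVec, mul_comm 2 η, mul_smul, smul_sum (r := 2)]
    simp only [smul_mulVec, vecMulVec_mulVec, op_smul_eq_smul]
  refine fun t => ⟨fun i => ?_, hz_dual t⟩
  rw [hz_dual, hZ, hΔ, Matrix.sub_apply, Matrix.smul_apply, hmul, Pi.sub_apply, Pi.smul_apply,
    Finset.sum_apply, mul_apply, sum_filter]
  simp only [Matrix.sub_apply, Pi.sub_apply, Pi.smul_apply, smul_eq_mul, hmul, hX, hM, mul_ite,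
    mul_zero, mul_comm]
end
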